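/- Let $1\le p<\infty$, $r\in\mathbb{N}$, and suppose the sampling operators $G_n$, $n\in\mathbb{N}$, satisfy conditions (c1), (c1') and (c2') for some $s\in\mathbb{N}$ with $s\le 2r$. Then for every $f\in L_p(\mathbb{T})$ the sequence $(G_n(f))_{n\in\mathbb{N}}$ converges to $f$ in $L_p(\mathbb{T})$ if and only if $\|f_{\gamma/n,\,r}-f\|_{\ell_p(X_n)}\to 0$ as $n\to\infty$. -/

import Mathlib

open MeasureTheory Filter Finset

noncomputable def LpNorm (p : ℝ) (f : ℝ → ℝ) : ℝ :=
  (∫ x in (0:ℝ)..1, |f x| ^ p) ^ (1 / p)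

def MemLpT (p : ℝ) (f : ℝ → ℝ) : Prop :=
  Function.Periodic f 1 ∧ Measurable f ∧
    IntervalIntegrable (fun x => |f x| ^ p) MeasureTheory.volume 0 1

noncomputable def Delta (r : ℕ) (h : ℝ) (f : ℝ → ℝ) (x : ℝ) : ℝ :=
  ∑ ν ∈ Finset.range (r + 1), ((-1 : ℝ) ^ ν * (r.choose ν : ℝ)) * f (x + ((r : ℝ) - (ν : ℝ)) * h)

noncomputable def omegaMod (r : ℕ) (p : ℝ) (f : ℝ → ℝ) (δ : ℝ) : ℝ :=
  sSup {y | ∃ h : ℝ, 0 < h ∧ h < δ ∧ y = LpNorm p (Delta r h f)}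

noncomputable def steklov (r : ℕ) (δ : ℝ) (f : ℝ → ℝ) (x : ℝ) : ℝ :=
  (-1 : ℝ) ^ (r + 1) * (((2 * r).choose r : ℝ))⁻¹ * (2 / δ) *
    ∫ t in (-(δ / 2))..(δ / 2),
      ∑ ν ∈ Finset.range r,
        (-1 : ℝ) ^ ν * (((2 * r).choose ν : ℝ)) * f (x + (((r : ℝ) - (ν : ℝ)) / (r : ℝ)) * t)

noncomputable def ellp (p : ℝ) (n : ℕ) (x : ℕ → ℝ) (f : ℝ → ℝ) : ℝ :=
  ((1 / (n : ℝ)) * ∑ k ∈ Finset.range n, |f (x k)| ^ p) ^ (1 / p)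

def SobolevW (s : ℕ) (g : ℝ → ℝ) : Prop :=
  Function.Periodic g 1 ∧ ContDiff ℝ (s : ℕ∞) g

noncomputable def localMod (r : ℕ) (f : ℝ → ℝ) (x δ : ℝ) : ℝ :=
  sSup {y | ∃ t h : ℝ, t ∈ Set.Icc (x - r * δ / 2) (x + r * δ / 2) ∧
    (t + r * h) ∈ Set.Icc (x - r * δ / 2) (x + r * δ / 2) ∧ y = |Delta r h f t|}

noncomputable def tauMod (r : ℕ) (p : ℝ) (f : ℝ → ℝ) (δ : ℝ) : ℝ :=
  (∫ x in (0:ℝ)..1, localMod r f x δ ^ p) ^ (1 / p)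

def IsTrigPoly (n : ℕ) (T : ℝ → ℝ) : Prop :=
  ∃ c : ℤ → ℂ, ∀ x : ℝ, (T x : ℂ) =
    ∑ ℓ ∈ Finset.Icc (-(n : ℤ)) (n : ℤ),
      c ℓ * Complex.exp (2 * Real.pi * Complex.I * (ℓ : ℂ) * (x : ℂ))

noncomputable def tildeE (n : ℕ) (p : ℝ) (f : ℝ → ℝ) : ℝ :=
  sInf {y | ∃ Q q : ℝ → ℝ, IsTrigPoly n Q ∧ IsTrigPoly n q ∧
    (∀ x, q x ≤ f x ∧ f x ≤ Q x) ∧ y = LpNorm p (fun x => Q x - q x)}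

noncomputable def dirichlet (n : ℕ) (x : ℝ) : ℝ :=
  ∑ ℓ ∈ Finset.Icc (-(n : ℤ)) (n : ℤ), Real.cos (2 * Real.pi * (ℓ : ℝ) * x)

noncomputable def lagrange (n : ℕ) (f : ℝ → ℝ) (x : ℝ) : ℝ :=
  (1 / (2 * (n : ℝ) + 1)) * ∑ k ∈ Finset.range (2 * n + 1),
    f ((k : ℝ) / (2 * (n : ℝ) + 1)) * dirichlet n (x - (k : ℝ) / (2 * (n : ℝ) + 1))

def NodesOK (γ : ℝ) (X : ℕ → ℕ → ℝ) : Prop :=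
  ∀ n : ℕ, 1 ≤ n →
    (0 ≤ X n 0) ∧ (∀ k, k + 1 < n → X n k < X n (k + 1)) ∧ (X n (n - 1) < 1) ∧
    (∀ k, k + 1 < n → γ / (n : ℝ) ≤ X n (k + 1) - X n k) ∧
    (γ / (n : ℝ) ≤ 1 + X n 0 - X n (n - 1))

def NodesOrd (X : ℕ → ℕ → ℝ) : Prop :=
  ∀ n : ℕ, 1 ≤ n →
    (0 ≤ X n 0) ∧ (∀ k, k + 1 < n → X n k < X n (k + 1)) ∧ (X n (n - 1) < 1)

def SamplingForm (p : ℝ) (X : ℕ → ℕ → ℝ) (φ : ℕ → ℕ → ℝ → ℝ)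
    (G : ℕ → (ℝ → ℝ) → ℝ → ℝ) : Prop :=
  (∀ n k, MemLpT p (φ n k)) ∧
  ∀ (n : ℕ) (f : ℝ → ℝ) (x : ℝ), G n f x = ∑ k ∈ Finset.range n, f (X n k) * φ n k x

def CondC1 (p K1 : ℝ) (X : ℕ → ℕ → ℝ) (G : ℕ → (ℝ → ℝ) → ℝ → ℝ) : Prop :=
  ∀ f : ℝ → ℝ, MemLpT p f → ∀ n : ℕ, 1 ≤ n → LpNorm p (G n f) ≤ K1 * ellp p n (X n) f

def CondC1' (p K2 : ℝ) (X : ℕ → ℕ → ℝ) (G : ℕ → (ℝ → ℝ) → ℝ → ℝ) : Prop :=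
  ∀ f : ℝ → ℝ, MemLpT p f → ∀ n : ℕ, 1 ≤ n → K2 * ellp p n (X n) f ≤ LpNorm p (G n f)

def CondC2' (p K3 : ℝ) (s : ℕ) (G : ℕ → (ℝ → ℝ) → ℝ → ℝ) : Prop :=
  ∀ g : ℝ → ℝ, SobolevW s g → ∀ n : ℕ, 1 ≤ n →
    LpNorm p (fun x => g x - G n g x) ≤ K3 / (n : ℝ) ^ s * LpNorm p (iteratedDeriv s g)

def CondC3 (p K5 : ℝ) (s : ℕ) (G : ℕ → (ℝ → ℝ) → ℝ → ℝ) : Prop :=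
  ∀ f : ℝ → ℝ, MemLpT p f → ∀ n : ℕ, 1 ≤ n →
    SobolevW s (G n f) ∧
    (1 / (n : ℝ) ^ s) * LpNorm p (iteratedDeriv s (G n f)) ≤
      K5 * omegaMod s p (G n f) (1 / (n : ℝ))

noncomputable def Gprev (G : ℕ → (ℝ → ℝ) → ℝ → ℝ) (f : ℝ → ℝ) (ν : ℕ) : ℝ → ℝ :=
  if ν = 0 then fun _ => 0 else G (2 ^ (ν - 1)) f

def CondC4 (p K4 : ℝ) (s : ℕ) (G : ℕ → (ℝ → ℝ) → ℝ → ℝ) (f : ℝ → ℝ) : Prop :=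
  ∀ ν : ℕ,
    SobolevW s (fun x => G (2 ^ ν) f x - Gprev G f ν x) ∧
    LpNorm p (iteratedDeriv s (fun x => G (2 ^ ν) f x - Gprev G f ν x)) ≤
      K4 * 2 ^ (s * ν) * LpNorm p (fun x => G (2 ^ ν) f x - Gprev G f ν x)

noncomputable def Kfun (s : ℕ) (p : ℝ) (n : ℕ) (x : ℕ → ℝ) (f : ℝ → ℝ) : ℝ :=
  sInf {y | ∃ g : ℝ → ℝ, SobolevW s g ∧
    y = ellp p n x (fun t => f t - g t) + LpNorm p (fun t => f t - g t) +
        (1 / (n : ℝ) ^ s) * LpNorm p (iteratedDeriv s g)}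


noncomputable abbrev mu01 : Measure ℝ := volume.restrict (Set.Ioc (0:ℝ) 1)

lemma MemLpT.memLp {p : ℝ} (hp : 1 ≤ p) {f : ℝ → ℝ} (hf : MemLpT p f) :
    MemLp f (ENNReal.ofReal p) mu01 := by
  have h0 : (0:ℝ) < p := by linarith
  rw [← integrable_norm_rpow_iff hf.2.1.aestronglyMeasurable (by simpa using h0) (by simp)]
  have := hf.2.2
  rw [intervalIntegrable_iff_integrableOn_Ioc_of_le zero_le_one] at this
  simpa [ENNReal.toReal_ofReal h0.le, IntegrableOn] using this

lemma memLpT_of {p : ℝ} (hp : 1 ≤ p) {f : ℝ → ℝ} (h1 : Function.Periodic f 1) (h2 : Measurable f)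
    (h3 : MemLp f (ENNReal.ofReal p) mu01) : MemLpT p f := by
  have h0 : (0:ℝ) < p := by linarith
  refine ⟨h1, h2, ?_⟩
  rw [← integrable_norm_rpow_iff h2.aestronglyMeasurable (by simpa using h0) (by simp)] at h3
  rw [intervalIntegrable_iff_integrableOn_Ioc_of_le zero_le_one]
  simpa [ENNReal.toReal_ofReal h0.le, IntegrableOn] using h3

lemma LpNorm_eq {p : ℝ} (hp : 1 ≤ p) {f : ℝ → ℝ} (hf : MemLpT p f) :
    LpNorm p f = (eLpNorm f (ENNReal.ofReal p) mu01).toReal := by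
  have h0 : (0:ℝ) < p := by linarith
  rw [(hf.memLp hp).eLpNorm_eq_integral_rpow_norm (by simpa using h0) (by simp),
    ENNReal.toReal_ofReal (by positivity), ENNReal.toReal_ofReal h0.le, LpNorm,
    intervalIntegral.integral_of_le zero_le_one]
  simp

lemma MemLpT.add {p : ℝ} (hp : 1 ≤ p) {f g : ℝ → ℝ} (hf : MemLpT p f) (hg : MemLpT p g) :
    MemLpT p (fun x => f x + g x) :=
  memLpT_of hp (hf.1.add hg.1) (hf.2.1.add hg.2.1) ((hf.memLp hp).add (hg.memLp hp))

lemma MemLpT.smul {p : ℝ} (hp : 1 ≤ p) {f : ℝ → ℝ} (hf : MemLpT p f) (c : ℝ) :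
    MemLpT p (fun x => c * f x) :=
  memLpT_of hp (fun x => by simp only [hf.1 x]) (hf.2.1.const_mul c) ((hf.memLp hp).const_mul c)

lemma MemLpT.sub {p : ℝ} (hp : 1 ≤ p) {f g : ℝ → ℝ} (hf : MemLpT p f) (hg : MemLpT p g) :
    MemLpT p (fun x => f x - g x) :=
  memLpT_of hp (hf.1.sub hg.1) (hf.2.1.sub hg.2.1) ((hf.memLp hp).sub (hg.memLp hp))

lemma MemLpT.sum {p : ℝ} (hp : 1 ≤ p) (n : ℕ) (c : ℕ → ℝ) (φ : ℕ → ℝ → ℝ)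
    (h : ∀ k, MemLpT p (φ k)) : MemLpT p (fun x => ∑ k ∈ Finset.range n, c k * φ k x) := by
  induction n with
  | zero =>
    simp only [Finset.range_zero, Finset.sum_empty]
    simpa using (h 0).smul hp 0
  | succ n ih =>
    simp only [Finset.sum_range_succ]
    exact ih.add hp ((h n).smul hp _)

lemma LpNorm_add_le {p : ℝ} (hp : 1 ≤ p) {f g : ℝ → ℝ} (hf : MemLpT p f) (hg : MemLpT p g) :
    LpNorm p (fun x => f x + g x) ≤ LpNorm p f + LpNorm p g := by
  rw [LpNorm_eq hp hf, LpNorm_eq hp hg, LpNorm_eq hp (hf.add hp hg),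
    ← ENNReal.toReal_add (hf.memLp hp).2.ne (hg.memLp hp).2.ne]
  refine ENNReal.toReal_mono (ENNReal.add_ne_top.2 ⟨(hf.memLp hp).2.ne, (hg.memLp hp).2.ne⟩) ?_
  exact eLpNorm_add_le (hf.memLp hp).1 (hg.memLp hp).1 (by simpa using hp)

lemma LpNorm_sub_comm (p : ℝ) (f g : ℝ → ℝ) :
    LpNorm p (fun x => f x - g x) = LpNorm p (fun x => g x - f x) := by
  simp only [LpNorm, abs_sub_comm]

lemma LpNorm_nonneg (p : ℝ) (f : ℝ → ℝ) : 0 ≤ LpNorm p f := by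
  unfold LpNorm
  apply Real.rpow_nonneg
  apply intervalIntegral.integral_nonneg zero_le_one
  intros; positivity

lemma memLpT_of_continuous {p : ℝ} (hp : 1 ≤ p) {f : ℝ → ℝ} (h1 : Function.Periodic f 1)
    (h2 : Continuous f) : MemLpT p f := by
  refine ⟨h1, h2.measurable, ?_⟩
  exact (h2.abs.rpow_const (fun x => Or.inr (by linarith))).intervalIntegrable _ _

lemma ellp_nonneg (p : ℝ) (n : ℕ) (x : ℕ → ℝ) (f : ℝ → ℝ) : 0 ≤ ellp p n x f := by
  unfold ellp; positivity

lemma ellp_add_le {p : ℝ} (hp : 1 ≤ p) (n : ℕ) (x : ℕ → ℝ) (f g : ℝ → ℝ) :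
    ellp p n x (fun t => f t + g t) ≤ ellp p n x f + ellp p n x g := by
  unfold ellp
  have h0 : (0:ℝ) ≤ 1 / (n:ℝ) := by positivity
  rw [Real.mul_rpow h0 (by positivity), Real.mul_rpow h0 (by positivity),
    Real.mul_rpow h0 (by positivity), ← mul_add]
  exact mul_le_mul_of_nonneg_left (Real.Lp_add_le _ _ _ hp) (by positivity)

lemma ellp_sub_comm (p : ℝ) (n : ℕ) (x : ℕ → ℝ) (f g : ℝ → ℝ) :
    ellp p n x (fun t => f t - g t) = ellp p n x (fun t => g t - f t) := by
  simp only [ellp, abs_sub_comm]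

lemma ellp_le_of_le {p : ℝ} (hp : 1 ≤ p) {n : ℕ} (hn : 1 ≤ n) (x : ℕ → ℝ) (f : ℝ → ℝ) {c : ℝ}
    (hc : 0 ≤ c) (h : ∀ t, |f t| ≤ c) : ellp p n x f ≤ c := by
  unfold ellp
  have h0 : (0:ℝ) < p := by linarith
  have hn' : (0:ℝ) < n := by exact_mod_cast hn
  have : (1 / (n : ℝ)) * ∑ k ∈ Finset.range n, |f (x k)| ^ p ≤ c ^ p := by
    have : ∑ k ∈ Finset.range n, |f (x k)| ^ p ≤ ∑ k ∈ Finset.range n, c ^ p :=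
      Finset.sum_le_sum fun k _ => Real.rpow_le_rpow (abs_nonneg _) (h _) h0.le
    rw [Finset.sum_const, Finset.card_range, nsmul_eq_mul] at this
    rw [one_div, inv_mul_le_iff₀ hn']
    exact this
  calc _ ≤ (c ^ p) ^ (1 / p) := Real.rpow_le_rpow (by positivity) this (by positivity)
    _ = c := by rw [← Real.rpow_mul hc, mul_one_div_cancel h0.ne', Real.rpow_one]

lemma exists_smooth {p : ℝ} (hp : 1 ≤ p) {f : ℝ → ℝ} (hf : MemLpT p f) {ε : ℝ} (hε : 0 < ε) :
    ∃ g : ℝ → ℝ, Function.Periodic g 1 ∧ (∀ s : ℕ, ContDiff ℝ (s : ℕ∞) g) ∧ UniformContinuous g ∧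
      LpNorm p (fun x => f x - g x) ≤ ε := by
  have : Fact (1 ≤ ENNReal.ofReal p) := ⟨by simpa using hp⟩
  have : Fact ((0:ℝ) < 1) := ⟨one_pos⟩
  have hmp : MeasurePreserving (QuotientAddGroup.mk : ℝ → AddCircle (1:ℝ)) mu01
      (AddCircle.haarAddCircle (T := (1:ℝ))) := by
    have := AddCircle.measurePreserving_mk (1:ℝ) 0
    rw [AddCircle.volume_eq_smul_haarAddCircle] at this
    simpa using this
  let F : AddCircle (1:ℝ) → ℂ := fun x => ((hf.1.lift x : ℝ) : ℂ)
  have hFc : ∀ x : ℝ, F (QuotientAddGroup.mk x) = f x := fun x => by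
    simp only [F]
    exact congrArg _ (hf.1.lift_coe x)
  have hFm : Measurable F := by
    have : F = fun x => ((f ((AddCircle.measurableEquivIoc (1:ℝ) 0 x : Set.Ioc (0:ℝ) (0 + 1)) : ℝ) : ℝ) : ℂ) := by
      funext x
      have h := (AddCircle.equivIoc (1:ℝ) 0).symm_apply_apply x
      conv_lhs => rw [← h]
      exact hFc _
    rw [this]
    exact Complex.measurable_ofReal.comp (hf.2.1.comp (measurable_subtype_coe.comp
      (AddCircle.measurableEquivIoc (1:ℝ) 0).measurable))
  have hFL : MemLp F (ENNReal.ofReal p) (AddCircle.haarAddCircle (T := (1:ℝ))) := by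
    refine ⟨hFm.aestronglyMeasurable, ?_⟩
    rw [← eLpNorm_comp_measurePreserving hFm.aestronglyMeasurable hmp]
    have : F ∘ (QuotientAddGroup.mk : ℝ → AddCircle (1:ℝ)) = fun x => ((f x : ℝ) : ℂ) := by
      funext x; exact hFc x
    rw [this]
    refine lt_of_le_of_lt (eLpNorm_mono (g := f) fun x => ?_) (hf.memLp hp).2
    simp
  have hcl : hFL.toLp F ∈ closure ((Submodule.span ℂ (Set.range (fourierLp (T := (1:ℝ)) (ENNReal.ofReal p))) :
      Submodule ℂ _) : Set (Lp ℂ (ENNReal.ofReal p) (AddCircle.haarAddCircle (T := (1:ℝ))))) := by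
    rw [← Submodule.topologicalClosure_coe, span_fourierLp_closure_eq_top (by simp)]
    trivial
  obtain ⟨h, hh, hd⟩ := Metric.mem_closure_iff.1 hcl ε hε
  have key : ∃ u : C(AddCircle (1:ℝ), ℂ), (∀ s : ℕ, ContDiff ℝ (s : ℕ∞) (fun x : ℝ => u (x : AddCircle (1:ℝ)))) ∧
      ContinuousMap.toLp (ENNReal.ofReal p) AddCircle.haarAddCircle ℂ u = h := by
    refine Submodule.span_induction (p := fun h _ => ∃ u : C(AddCircle (1:ℝ), ℂ), (∀ s : ℕ, ContDiff ℝ (s : ℕ∞) (fun x : ℝ => u (x : AddCircle (1:ℝ)))) ∧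
      ContinuousMap.toLp (ENNReal.ofReal p) AddCircle.haarAddCircle ℂ u = h) ?_ ?_ ?_ ?_ hh
    · rintro _ ⟨n, rfl⟩
      refine ⟨fourier n, fun s => ?_, rfl⟩
      simp only [fourier_coe_apply]
      have : ContDiff ℝ (s : ℕ∞) (fun x : ℝ => (x : ℂ)) := Complex.ofRealCLM.contDiff
      fun_prop
    · exact ⟨0, fun s => by simpa using contDiff_const, by simp⟩
    · rintro _ _ _ _ ⟨u, hu, rfl⟩ ⟨v, hv, rfl⟩
      exact ⟨u + v, fun s => (hu s).add (hv s), by simp⟩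
    · rintro c _ _ ⟨u, hu, rfl⟩
      exact ⟨c • u, fun s => (hu s).const_smul c, by simp⟩
  obtain ⟨u, hu, rfl⟩ := key
  have hper : Function.Periodic (fun x : ℝ => (u (x : AddCircle (1:ℝ))).re) 1 := fun x => by simp
  have hcd : ∀ s : ℕ, ContDiff ℝ (s : ℕ∞) (fun x : ℝ => (u (x : AddCircle (1:ℝ))).re) :=
    fun s => Complex.reCLM.contDiff.comp (hu s)
  refine ⟨fun x => (u (x : AddCircle (1:ℝ))).re, hper, hcd, ?_, ?_⟩
  · have h1 : UniformContinuous u := CompactSpace.uniformContinuous_of_continuous u.continuous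
    have h2 : UniformContinuous (QuotientAddGroup.mk' (AddSubgroup.zmultiples (1:ℝ))) :=
      uniformContinuous_of_continuousAt_zero _ (AddCircle.continuous_mk' (1:ℝ)).continuousAt
    exact Complex.reCLM.uniformContinuous.comp (h1.comp h2)
  · have hg := memLpT_of_continuous hp hper (hcd 0).continuous
    rw [LpNorm_eq hp (hf.sub hp hg)]
    rw [dist_eq_norm, Lp.norm_def] at hd
    have hae : (hFL.toLp F - ContinuousMap.toLp (ENNReal.ofReal p) AddCircle.haarAddCircle ℂ u : Lp ℂ (ENNReal.ofReal p) (AddCircle.haarAddCircle (T := (1:ℝ))))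
        =ᵐ[AddCircle.haarAddCircle] fun x => F x - u x := by
      filter_upwards [Lp.coeFn_sub (hFL.toLp F) (ContinuousMap.toLp (ENNReal.ofReal p) AddCircle.haarAddCircle ℂ u), hFL.coeFn_toLp,
        ContinuousMap.coeFn_toLp (p := ENNReal.ofReal p) AddCircle.haarAddCircle (𝕜 := ℂ) u] with x h1 h2 h3
      rw [h1, Pi.sub_apply, h2, h3]
    have hne := Lp.eLpNorm_ne_top (hFL.toLp F - ContinuousMap.toLp (ENNReal.ofReal p) AddCircle.haarAddCircle ℂ u)
    rw [eLpNorm_congr_ae hae] at hd hne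
    refine le_trans (ENNReal.toReal_mono hne ?_) hd.le
    rw [show (fun x => F x - u x) = F - ⇑u from rfl, ← eLpNorm_comp_measurePreserving (hFm.aestronglyMeasurable.sub u.continuous.aestronglyMeasurable) hmp]
    refine eLpNorm_mono fun x => ?_
    simp only [Function.comp, Pi.sub_apply, hFc]
    refine le_trans (le_of_eq ?_) (Complex.abs_re_le_norm _)
    simp only [Complex.sub_re, Complex.ofReal_re, Real.norm_eq_abs]

lemma ii_comp {h : ℝ → ℝ} (hh : ∀ a b, IntervalIntegrable h volume a b) (x : ℝ) {c : ℝ}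
    (hc : c ≠ 0) (a b : ℝ) : IntervalIntegrable (fun t => h (x + c * t)) volume a b := by
  have h1 := (hh (c * a + x) (c * b + x)).comp_add_left x
  have h2 := h1.comp_mul_left (c := c)
  simpa [hc] using h2

lemma coef_pos {r : ℕ} {ν : ℕ} (hν : ν ∈ Finset.range r) :
    (0:ℝ) < ((r : ℝ) - (ν : ℝ)) / (r : ℝ) ∧ ((r : ℝ) - (ν : ℝ)) / (r : ℝ) ≤ 1 ∧
      (((r : ℝ) - (ν : ℝ)) / (r : ℝ))⁻¹ ≤ r := by
  have h1 : ν + 1 ≤ r := Finset.mem_range.1 hν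
  have h2 : (ν : ℝ) + 1 ≤ r := by exact_mod_cast h1
  have h3 : (0:ℝ) ≤ ν := by positivity
  have hr : (0:ℝ) < r := by linarith
  refine ⟨div_pos (by linarith) hr, ?_, ?_⟩
  · rw [div_le_one hr]; linarith
  · rw [inv_div]
    exact div_le_self hr.le (by linarith)

lemma steklov_ii {h : ℝ → ℝ} (hh : ∀ a b, IntervalIntegrable h volume a b) (r : ℕ) (x a b : ℝ) :
    IntervalIntegrable (fun t => ∑ ν ∈ Finset.range r,
        (-1 : ℝ) ^ ν * (((2 * r).choose ν : ℝ)) * h (x + (((r : ℝ) - (ν : ℝ)) / (r : ℝ)) * t)) volume a b := by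
  have := IntervalIntegrable.sum (μ := volume) (a := a) (b := b) (Finset.range r)
    (f := fun ν t => (-1 : ℝ) ^ ν * (((2 * r).choose ν : ℝ)) * h (x + (((r : ℝ) - (ν : ℝ)) / (r : ℝ)) * t))
    (fun ν hν => (ii_comp hh x (coef_pos hν).1.ne' a b).const_mul _)
  have e : (∑ i ∈ Finset.range r, fun t => (-1 : ℝ) ^ i * (((2 * r).choose i : ℝ)) * h (x + (((r : ℝ) - (i : ℝ)) / (r : ℝ)) * t))
      = (fun t => ∑ ν ∈ Finset.range r,
        (-1 : ℝ) ^ ν * (((2 * r).choose ν : ℝ)) * h (x + (((r : ℝ) - (ν : ℝ)) / (r : ℝ)) * t)) := by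
    funext t; simp
  rw [← e]; exact this

lemma steklov_sub {f g : ℝ → ℝ} (hf : ∀ a b, IntervalIntegrable f volume a b)
    (hg : ∀ a b, IntervalIntegrable g volume a b) (r : ℕ) (δ x : ℝ) :
    steklov r δ (fun t => f t - g t) x = steklov r δ f x - steklov r δ g x := by
  unfold steklov
  rw [← mul_sub, ← intervalIntegral.integral_sub (steklov_ii hf r x _ _) (steklov_ii hg r x _ _)]
  simp only [mul_sub, Finset.sum_sub_distrib]

lemma steklov_const {r : ℕ} (hr : 1 ≤ r) {δ : ℝ} (hδ : 0 < δ) (c x : ℝ) :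
    steklov r δ (fun _ => c) x = c := by
  unfold steklov
  obtain ⟨m, rfl⟩ : ∃ m, r = m + 1 := ⟨r - 1, by omega⟩
  have h1 := @Int.alternating_sum_range_choose_eq_choose (2 * m + 1) m
  have h2 : ∑ k ∈ Finset.range (m + 1), (-1 : ℝ) ^ k * ((2 * (m + 1)).choose k : ℝ)
      = (-1) ^ m * ((2 * m + 1).choose m : ℝ) := by exact_mod_cast h1
  have h3 : (2 * (m + 1)).choose (m + 1) = 2 * (2 * m + 1).choose m := by
    have a1 : (2 * (m + 1)) = (2 * m + 1) + 1 := by ring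
    rw [a1, Nat.choose_succ_succ, Nat.choose_symm_half]; ring
  have h4 : ((2 * m + 1).choose m : ℝ) ≠ 0 := by
    have : 0 < (2 * m + 1).choose m := Nat.choose_pos (by omega)
    positivity
  simp only [← Finset.sum_mul, h2]
  rw [intervalIntegral.integral_const, h3]
  push_cast
  have h5 : (-1 : ℝ) ^ (m + 1 + 1) * (-1) ^ m = 1 := by
    rw [← pow_add]; exact Even.neg_one_pow ⟨m + 1, by ring⟩
  rw [smul_eq_mul]
  field_simp
  linear_combination (2 * c) * h5

noncomputable def stC (r : ℕ) : ℝ := 2 * (r * ∑ ν ∈ Finset.range r, ((2 * r).choose ν : ℝ))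

lemma stC_nonneg (r : ℕ) : 0 ≤ stC r := by unfold stC; positivity

lemma steklov_bound {h : ℝ → ℝ} (hh : ∀ a b, IntervalIntegrable h volume a b) (r : ℕ) {δ : ℝ}
    (hδ : 0 < δ) (x : ℝ) :
    |steklov r δ h x| ≤ stC r * (δ⁻¹ * ∫ t in (x - δ / 2)..(x + δ / 2), |h t|) := by
  have hab : ∀ a b, IntervalIntegrable (fun t => |h t|) volume a b := fun a b => (hh a b).abs
  have hle : -(δ / 2) ≤ δ / 2 := by linarith
  have e1 : |∫ t in (-(δ / 2))..(δ / 2), ∑ ν ∈ Finset.range r,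
        (-1 : ℝ) ^ ν * (((2 * r).choose ν : ℝ)) * h (x + (((r : ℝ) - (ν : ℝ)) / (r : ℝ)) * t)|
      ≤ ∑ ν ∈ Finset.range r, ((2 * r).choose ν : ℝ) * (r * ∫ t in (x - δ / 2)..(x + δ / 2), |h t|) := by
    calc _ ≤ ∫ t in (-(δ / 2))..(δ / 2), ∑ ν ∈ Finset.range r,
            ((2 * r).choose ν : ℝ) * |h (x + (((r : ℝ) - (ν : ℝ)) / (r : ℝ)) * t)| := by
          refine (intervalIntegral.abs_integral_le_integral_abs hle).trans ?_
          refine intervalIntegral.integral_mono_on hle (steklov_ii hh r x _ _).abs ?_ ?_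
          · have := IntervalIntegrable.sum (μ := volume) (a := -(δ/2)) (b := δ/2) (Finset.range r)
              (f := fun ν t => (((2 * r).choose ν : ℝ)) * |h (x + (((r : ℝ) - (ν : ℝ)) / (r : ℝ)) * t)|)
              (fun ν hν => (ii_comp hab x (coef_pos hν).1.ne' _ _).const_mul _)
            have e : (∑ i ∈ Finset.range r, fun t => (((2 * r).choose i : ℝ)) * |h (x + (((r : ℝ) - (i : ℝ)) / (r : ℝ)) * t)|)
                = (fun t => ∑ ν ∈ Finset.range r,
                  (((2 * r).choose ν : ℝ)) * |h (x + (((r : ℝ) - (ν : ℝ)) / (r : ℝ)) * t)|) := by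
              funext t; simp
            rw [← e]; exact this
          · intro t _
            refine (Finset.abs_sum_le_sum_abs _ _).trans (le_of_eq ?_)
            refine Finset.sum_congr rfl fun ν _ => ?_
            rw [abs_mul, abs_mul, abs_pow, abs_neg, abs_one, one_pow, one_mul, Nat.abs_cast]
      _ = ∑ ν ∈ Finset.range r, ((2 * r).choose ν : ℝ) *
            ∫ t in (-(δ / 2))..(δ / 2), |h (x + (((r : ℝ) - (ν : ℝ)) / (r : ℝ)) * t)| := by
          rw [intervalIntegral.integral_finsetSum]
          · simp only [intervalIntegral.integral_const_mul]
          · exact fun ν hν => (ii_comp hab x (coef_pos hν).1.ne' _ _).const_mul _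
      _ ≤ _ := by
          refine Finset.sum_le_sum fun ν hν => mul_le_mul_of_nonneg_left ?_ (by positivity)
          obtain ⟨c0, c1, c2⟩ := coef_pos hν
          set c := ((r : ℝ) - (ν : ℝ)) / (r : ℝ)
          rw [intervalIntegral.integral_comp_add_mul (fun t => |h t|) c0.ne' x, smul_eq_mul]
          have hcd : c * (δ / 2) ≤ δ / 2 := by nlinarith
          have hcd0 : 0 ≤ c * (δ / 2) := by positivity
          refine mul_le_mul c2 ?_ ?_ (by positivity)
          · refine intervalIntegral.integral_mono_interval (by linarith) (by linarith) (by linarith)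
              (ae_of_all _ fun t => abs_nonneg _) (hab _ _)
          · exact intervalIntegral.integral_nonneg (by linarith) fun t _ => abs_nonneg _
  have hI : 0 ≤ ∫ t in (x - δ / 2)..(x + δ / 2), |h t| :=
    intervalIntegral.integral_nonneg (by linarith) fun t _ => abs_nonneg _
  rw [← Finset.sum_mul] at e1
  unfold steklov stC
  have hb : (((2 * r).choose r : ℝ))⁻¹ ≤ 1 := by
    apply inv_le_one_of_one_le₀
    exact_mod_cast Nat.choose_pos (by omega)
  rw [abs_mul, abs_mul, abs_mul, abs_pow, abs_neg, abs_one, one_pow, one_mul,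
    abs_of_nonneg (by positivity : (0:ℝ) ≤ (((2 * r).choose r : ℝ))⁻¹),
    abs_of_nonneg (by positivity : (0:ℝ) ≤ 2 / δ)]
  calc _ ≤ (1 * (2 / δ)) * _ := by
        refine mul_le_mul (mul_le_mul_of_nonneg_right hb (by positivity)) e1 (abs_nonneg _) (by positivity)
    _ = _ := by ring

lemma steklov_bound_p {p : ℝ} (hp : 1 ≤ p) {h : ℝ → ℝ} (hh : ∀ a b, IntervalIntegrable h volume a b)
    (hh' : ∀ a b, IntervalIntegrable (fun t => |h t| ^ p) volume a b) (r : ℕ) {δ : ℝ}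
    (hδ : 0 < δ) (x : ℝ) :
    |steklov r δ h x| ^ p ≤ stC r ^ p * (δ⁻¹ * ∫ t in (x - δ / 2)..(x + δ / 2), |h t| ^ p) := by
  have h0 : (0:ℝ) < p := by linarith
  have hI : 0 ≤ ∫ t in (x - δ / 2)..(x + δ / 2), |h t| :=
    intervalIntegral.integral_nonneg (by linarith) fun t _ => abs_nonneg _
  refine (Real.rpow_le_rpow (abs_nonneg _) (steklov_bound hh r hδ x) h0.le).trans ?_
  rw [Real.mul_rpow (stC_nonneg r) (by positivity)]
  refine mul_le_mul_of_nonneg_left ?_ (Real.rpow_nonneg (stC_nonneg r) _)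
  have hlt : x - δ / 2 ≤ x + δ / 2 := by linarith
  have hlen : x + δ / 2 - (x - δ / 2) = δ := by ring
  have key := (convexOn_rpow hp).map_set_average_le (μ := volume)
    (t := Set.Ioc (x - δ / 2) (x + δ / 2)) (f := fun t => |h t|)
    (continuousOn_id.rpow_const fun _ _ => Or.inr h0.le) isClosed_Ici
    (by rw [Real.volume_Ioc, hlen]; simpa using hδ) (by rw [Real.volume_Ioc]; simp)
    (ae_of_all _ fun t => Set.mem_Ici.2 (abs_nonneg _))
    ((intervalIntegrable_iff_integrableOn_Ioc_of_le hlt).1 (hh _ _).abs)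
    ((intervalIntegrable_iff_integrableOn_Ioc_of_le hlt).1 (hh' _ _))
  simp only [setAverage_eq, smul_eq_mul, Real.volume_real_Ioc_of_le hlt, hlen] at key
  rw [intervalIntegral.integral_of_le hlt, intervalIntegral.integral_of_le hlt]
  exact key

lemma sum_intervals {F : ℝ → ℝ} (hF : ∀ a b, IntervalIntegrable F volume a b) (h0 : ∀ t, 0 ≤ F t)
    {δ : ℝ} (hδ : 0 < δ) (x : ℕ → ℝ) (n : ℕ) (hx : ∀ k, k + 1 < n → δ ≤ x (k + 1) - x k)
    (m : ℕ) (hm : m < n) :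
    x 0 ≤ x m ∧ ∑ k ∈ Finset.range (m + 1), ∫ t in (x k - δ / 2)..(x k + δ / 2), F t ≤
      ∫ t in (x 0 - δ / 2)..(x m + δ / 2), F t := by
  induction m with
  | zero => simp
  | succ m ih =>
    obtain ⟨i1, i2⟩ := ih (by omega)
    have hd := hx m hm
    refine ⟨by linarith, ?_⟩
    rw [Finset.sum_range_succ,
      ← intervalIntegral.integral_add_adjacent_intervals (hF (x 0 - δ / 2) (x m + δ / 2)) (hF _ _)]
    refine add_le_add i2 ?_
    exact intervalIntegral.integral_mono_interval (by linarith) (by linarith) (by linarith)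
              (ae_of_all _ fun t => h0 t) (hF _ _)

lemma MemLpT.ii_p {p : ℝ} {f : ℝ → ℝ} (hf : MemLpT p f) :
    ∀ a b, IntervalIntegrable (fun t => |f t| ^ p) volume a b := by
  have : Function.Periodic (fun t => |f t| ^ p) 1 := fun x => by simp only [hf.1 x]
  exact this.intervalIntegrable one_ne_zero (t := 0) (by simpa using hf.2.2)

lemma MemLpT.ii {p : ℝ} (hp : 1 ≤ p) {f : ℝ → ℝ} (hf : MemLpT p f) :
    ∀ a b, IntervalIntegrable f volume a b := by
  refine hf.1.intervalIntegrable one_ne_zero (t := 0) ?_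
  rw [zero_add, intervalIntegrable_iff_integrableOn_Ioc_of_le zero_le_one]
  exact (hf.memLp hp).integrable (by simpa using hp)

lemma ellp_steklov_le {p γ : ℝ} (hp : 1 ≤ p) (hγ : 0 < γ) (r : ℕ) {h : ℝ → ℝ} (hh : MemLpT p h)
    {n : ℕ} (hn : 1 ≤ n) (x : ℕ → ℝ) (hx : ∀ k, k + 1 < n → γ / (n : ℝ) ≤ x (k + 1) - x k)
    (hx' : γ / (n : ℝ) ≤ 1 + x 0 - x (n - 1)) :
    ellp p n x (steklov r (γ / (n : ℝ)) h) ≤ (stC r * (γ⁻¹) ^ (1 / p)) * LpNorm p h := by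
  have h0 : (0:ℝ) < p := by linarith
  have hn' : (0:ℝ) < n := by exact_mod_cast hn
  set δ := γ / (n : ℝ) with hδd
  have hδ : 0 < δ := by positivity
  have hF0 : ∀ t, 0 ≤ |h t| ^ p := fun t => by positivity
  have hI : 0 ≤ ∫ t in (0:ℝ)..1, |h t| ^ p := intervalIntegral.integral_nonneg zero_le_one fun t _ => hF0 t
  have hs : ∑ k ∈ Finset.range n, ∫ t in (x k - δ / 2)..(x k + δ / 2), |h t| ^ p
      ≤ ∫ t in (0:ℝ)..1, |h t| ^ p := by
    obtain ⟨m, rfl⟩ : ∃ m, n = m + 1 := ⟨n - 1, by omega⟩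
    obtain ⟨a1, a2⟩ := sum_intervals hh.ii_p hF0 hδ x (m + 1) hx m (by omega)
    refine a2.trans ?_
    have hper : Function.Periodic (fun t => |h t| ^ p) 1 := fun x => by simp only [hh.1 x]
    have := hper.intervalIntegral_add_eq (x 0 - δ / 2) 0
    rw [zero_add] at this
    rw [← this]
    simp only [Nat.add_sub_cancel] at hx'
    exact intervalIntegral.integral_mono_interval le_rfl (by linarith) (by linarith)
              (ae_of_all _ fun t => hF0 t) (hh.ii_p _ _)
  have hmain : (1 / (n : ℝ)) * ∑ k ∈ Finset.range n, |steklov r δ h (x k)| ^ p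
      ≤ (stC r ^ p * γ⁻¹) * ∫ t in (0:ℝ)..1, |h t| ^ p := by
    calc _ ≤ (1 / (n : ℝ)) * ∑ k ∈ Finset.range n,
          stC r ^ p * (δ⁻¹ * ∫ t in (x k - δ / 2)..(x k + δ / 2), |h t| ^ p) := by
          refine mul_le_mul_of_nonneg_left ?_ (by positivity)
          exact Finset.sum_le_sum fun k _ => steklov_bound_p hp (hh.ii hp) hh.ii_p r hδ (x k)
      _ = (stC r ^ p * γ⁻¹) * ∑ k ∈ Finset.range n, ∫ t in (x k - δ / 2)..(x k + δ / 2), |h t| ^ p := by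
          rw [← Finset.mul_sum, ← Finset.mul_sum]
          have : δ⁻¹ = n * γ⁻¹ := by rw [hδd, inv_div]; rfl
          rw [this]
          generalize (∑ k ∈ Finset.range n, ∫ t in (x k - δ / 2)..(x k + δ / 2), |h t| ^ p) = S
          field_simp
      _ ≤ _ := mul_le_mul_of_nonneg_left hs
          (mul_nonneg (Real.rpow_nonneg (stC_nonneg r) _) (by positivity))
  unfold ellp LpNorm
  refine (Real.rpow_le_rpow (by positivity) hmain (by positivity)).trans (le_of_eq ?_)
  have hC : 0 ≤ stC r ^ p := Real.rpow_nonneg (stC_nonneg r) _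
  rw [Real.mul_rpow (by positivity) hI, Real.mul_rpow hC (by positivity),
    ← Real.rpow_mul (stC_nonneg r), mul_one_div_cancel h0.ne', Real.rpow_one]

lemma steklov_smooth {r : ℕ} (hr : 1 ≤ r) {g : ℝ → ℝ} (hg : UniformContinuous g) {η : ℝ} (hη : 0 < η) :
    ∃ d > 0, ∀ δ, 0 < δ → δ < d → ∀ x, |steklov r δ g x - g x| ≤ stC r * η := by
  obtain ⟨d, hd, H⟩ := Metric.uniformContinuous_iff.1 hg η hη
  refine ⟨d, hd, fun δ hδ hδd x => ?_⟩
  have hgi : ∀ a b, IntervalIntegrable g volume a b := fun a b => hg.continuous.intervalIntegrable a b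
  have hci : ∀ a b, IntervalIntegrable (fun _ : ℝ => g x) volume a b := fun a b => intervalIntegrable_const
  have e : steklov r δ g x - g x = steklov r δ (fun t => g t - g x) x := by
    rw [steklov_sub hgi hci, steklov_const hr hδ]
  rw [e]
  refine (steklov_bound (fun a b => (hgi a b).sub (hci a b)) r hδ x).trans ?_
  refine mul_le_mul_of_nonneg_left ?_ (stC_nonneg r)
  rw [inv_mul_le_iff₀ hδ]
  have hlen : x + δ / 2 - (x - δ / 2) = δ := by ring
  calc _ ≤ ∫ t in (x - δ / 2)..(x + δ / 2), η := by
        refine intervalIntegral.integral_mono_on (by linarith) ((hgi _ _).sub (hci _ _)).abs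
          intervalIntegrable_const fun t ht => ?_
        have : dist (g t) (g x) < η := H (by
          rw [Real.dist_eq, abs_lt]; constructor <;> linarith [ht.1, ht.2])
        exact this.le
    _ = δ * η := by rw [intervalIntegral.integral_const, hlen, smul_eq_mul]

theorem stmt5 (p γ : ℝ) (r s : ℕ) (X : ℕ → ℕ → ℝ) (φ : ℕ → ℕ → ℝ → ℝ)
    (G : ℕ → (ℝ → ℝ) → ℝ → ℝ)
    (hp : 1 ≤ p) (hr : 1 ≤ r) (hs : 1 ≤ s) (hsr : s ≤ 2 * r)
    (hγ0 : 0 < γ) (hγ1 : γ ≤ 1) (hX : NodesOK γ X) (hGform : SamplingForm p X φ G)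
    (K1 : ℝ) (hK1 : 0 < K1) (hc1 : CondC1 p K1 X G) (K2 : ℝ) (hK2 : 0 < K2) (hc1' : CondC1' p K2 X G) (K3 : ℝ) (hK3 : 0 < K3) (hc2' : CondC2' p K3 s G) :
    ∀ f : ℝ → ℝ, MemLpT p f →
      (Filter.Tendsto (fun n : ℕ => LpNorm p (fun x => f x - G n f x)) Filter.atTop (nhds 0) ↔
        Filter.Tendsto (fun n : ℕ => ellp p n (X n) (fun x => steklov r (γ / (n : ℝ)) f x - f x)) Filter.atTop (nhds 0)) := by

  intro f hf
  obtain ⟨hφ, hG⟩ := hGform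
  have hGm : ∀ n u, MemLpT p (G n u) := fun n u => by
    have : G n u = fun x => ∑ k ∈ Finset.range n, u (X n k) * φ n k x := funext fun x => hG n u x
    rw [this]
    exact MemLpT.sum hp n _ _ (hφ n)
  have hGsub : ∀ n u v, G n (fun x => u x - v x) = fun x => G n u x - G n v x := fun n u v => by
    funext x
    simp only [hG, sub_mul, Finset.sum_sub_distrib]
  set C := stC r * (γ⁻¹) ^ (1 / p) with hC
  have hC0 : 0 ≤ C := mul_nonneg (stC_nonneg r) (by positivity)
  set A : ℕ → ℝ := fun n => LpNorm p (fun x => f x - G n f x) with hA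
  set B : ℕ → ℝ := fun n => ellp p n (X n) (fun x => steklov r (γ / (n : ℝ)) f x - f x) with hB
  have hA0 : ∀ n, 0 ≤ A n := fun n => LpNorm_nonneg _ _
  have hB0 : ∀ n, 0 ≤ B n := fun n => ellp_nonneg _ _ _ _
  -- the key comparison
  have key : ∀ ε > 0, ∀ᶠ n in atTop, A n ≤ (2 + K1 * (C + 1)) * ε + K1 * B n ∧
      B n ≤ (C + 1) * ε + (2 * ε + A n) / K2 := by
    intro ε hε
    obtain ⟨g, gper, gsm, guc, hfg⟩ := exists_smooth hp hf hε
    have gm : MemLpT p g := memLpT_of_continuous hp gper guc.continuous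
    have o1 : ∀ᶠ n : ℕ in atTop, LpNorm p (fun x => g x - G n g x) ≤ ε := by
      have t1 : Tendsto (fun n : ℕ => K3 / (n : ℝ) ^ s * LpNorm p (iteratedDeriv s g)) atTop (nhds 0) := by
        have : Tendsto (fun n : ℕ => (n : ℝ) ^ s) atTop atTop :=
          (tendsto_pow_atTop (by omega)).comp tendsto_natCast_atTop_atTop
        simpa using (this.const_div_atTop K3).mul_const (LpNorm p (iteratedDeriv s g))
      filter_upwards [t1.eventually (gt_mem_nhds hε), eventually_ge_atTop 1] with n h1 h2
      exact (hc2' g ⟨gper, gsm s⟩ n h2).trans h1.le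
    have o2 : ∀ᶠ n : ℕ in atTop, ellp p n (X n) (fun x => steklov r (γ / (n : ℝ)) g x - g x) ≤ ε := by
      have hpos : 0 < ε / (stC r + 1) := div_pos hε (by linarith [stC_nonneg r])
      obtain ⟨d, hd, H⟩ := steklov_smooth hr guc hpos
      have t1 : Tendsto (fun n : ℕ => γ / (n : ℝ)) atTop (nhds 0) :=
        tendsto_natCast_atTop_atTop.const_div_atTop γ
      filter_upwards [t1.eventually (gt_mem_nhds hd), eventually_ge_atTop 1] with n h1 h2
      refine ellp_le_of_le hp h2 _ _ hε.le fun t => ?_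
      have hn' : (0:ℝ) < n := by exact_mod_cast h2
      refine (H (γ / n) (by positivity) h1 t).trans ?_
      rw [mul_div_assoc', div_le_iff₀ (by linarith [stC_nonneg r])]
      nlinarith [stC_nonneg r]
    filter_upwards [o1, o2, eventually_ge_atTop 1] with n h1 h2 hn
    obtain ⟨_, _, _, x1, x2⟩ := hX n hn
    have hfgm : MemLpT p (fun x => f x - g x) := hf.sub hp gm
    set E := ellp p n (X n) (fun x => f x - g x) with hE
    have hst : ellp p n (X n) (fun x => steklov r (γ / (n : ℝ)) f x - steklov r (γ / (n : ℝ)) g x) ≤ C * ε := by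
      have := ellp_steklov_le hp hγ0 r hfgm hn (X n) x1 x2
      have e : steklov r (γ / (n : ℝ)) (fun x => f x - g x) =
          fun x => steklov r (γ / (n : ℝ)) f x - steklov r (γ / (n : ℝ)) g x :=
        funext fun x => steklov_sub (hf.ii hp) (gm.ii hp) _ _ _
      rw [e] at this
      exact this.trans (mul_le_mul_of_nonneg_left hfg hC0)
    have u1 : LpNorm p (fun x => G n f x - G n g x) ≤ K1 * E := by
      have := hc1 _ hfgm n hn
      rwa [hGsub] at this
    have u2 : K2 * E ≤ LpNorm p (fun x => G n f x - G n g x) := by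
      have := hc1' _ hfgm n hn
      rwa [hGsub] at this
    have v1 : A n ≤ ε + (ε + LpNorm p (fun x => G n f x - G n g x)) := by
      have e : (fun x => f x - G n f x) =
          fun x => (f x - g x) + ((g x - G n g x) + (G n g x - G n f x)) := by funext x; ring
      have m1 := (gm.sub hp (hGm n g))
      have m2 := ((hGm n g).sub hp (hGm n f))
      have := LpNorm_add_le hp hfgm (m1.add hp m2)
      have h3 := LpNorm_add_le hp m1 m2
      rw [LpNorm_sub_comm p (G n g)] at h3
      simp only [hA]
      rw [e]
      linarith
    have v2 : LpNorm p (fun x => G n f x - G n g x) ≤ A n + (ε + ε) := by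
      have e : (fun x => G n f x - G n g x) =
          fun x => (G n f x - f x) + ((f x - g x) + (g x - G n g x)) := by funext x; ring
      have m1 := (gm.sub hp (hGm n g))
      have m2 := ((hGm n f).sub hp hf)
      have := LpNorm_add_le hp m2 (hfgm.add hp m1)
      have h3 := LpNorm_add_le hp hfgm m1
      rw [LpNorm_sub_comm p (G n f) f] at this
      simp only [hA]
      rw [e]
      linarith
    have w1 : E ≤ B n + (C * ε + ε) := by
      have e : (fun x => f x - g x) = fun x => (f x - steklov r (γ / (n : ℝ)) f x) +
          ((steklov r (γ / (n : ℝ)) f x - steklov r (γ / (n : ℝ)) g x) +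
            (steklov r (γ / (n : ℝ)) g x - g x)) := by funext x; ring
      have i1 := ellp_add_le hp n (X n) (fun x => f x - steklov r (γ / (n : ℝ)) f x)
        (fun x => (steklov r (γ / (n : ℝ)) f x - steklov r (γ / (n : ℝ)) g x) +
            (steklov r (γ / (n : ℝ)) g x - g x))
      have i2 := ellp_add_le hp n (X n)
        (fun x => (steklov r (γ / (n : ℝ)) f x - steklov r (γ / (n : ℝ)) g x))
        (fun x => (steklov r (γ / (n : ℝ)) g x - g x))
      rw [ellp_sub_comm p n (X n) f] at i1
      rw [hE, e]
      simp only [hB]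
      linarith
    have w2 : B n ≤ (C * ε + ε) + E := by
      have e : (fun x => steklov r (γ / (n : ℝ)) f x - f x) = fun x =>
          ((steklov r (γ / (n : ℝ)) f x - steklov r (γ / (n : ℝ)) g x) +
            (steklov r (γ / (n : ℝ)) g x - g x)) + (g x - f x) := by funext x; ring
      have i1 := ellp_add_le hp n (X n)
        (fun x => (steklov r (γ / (n : ℝ)) f x - steklov r (γ / (n : ℝ)) g x) +
            (steklov r (γ / (n : ℝ)) g x - g x)) (fun x => g x - f x)
      have i2 := ellp_add_le hp n (X n)
        (fun x => (steklov r (γ / (n : ℝ)) f x - steklov r (γ / (n : ℝ)) g x))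
        (fun x => (steklov r (γ / (n : ℝ)) g x - g x))
      rw [ellp_sub_comm p n (X n) g] at i1
      simp only [hB]
      rw [e]
      linarith
    constructor
    · have := mul_le_mul_of_nonneg_left w1 hK1.le
      linarith
    · have : E ≤ (2 * ε + A n) / K2 := by
        rw [le_div_iff₀ hK2]; linarith
      linarith
  constructor
  · intro h
    have main : ∀ η > 0, ∀ᶠ n in atTop, B n < η := by
      intro η hη
      set D := (C + 1) + 2 / K2 with hD
      have hDpos : 0 < D := by positivity
      have hε : 0 < η / (2 * D) := by positivity
      have hη2 : 0 < K2 * (η / 2) := by positivity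
      filter_upwards [key _ hε, h.eventually (gt_mem_nhds hη2)] with n h1 h2
      have h3 : A n / K2 < η / 2 := by rw [div_lt_iff₀ hK2]; linarith
      have h4 : D * (η / (2 * D)) = η / 2 := by field_simp
      have h5 := h1.2
      have h6 : (C + 1) * (η / (2 * D)) + (2 * (η / (2 * D)) + A n) / K2
          = D * (η / (2 * D)) + A n / K2 := by rw [hD]; ring
      linarith
    refine tendsto_order.2 ⟨fun a ha => Eventually.of_forall fun n => lt_of_lt_of_le ha (hB0 n), main⟩
  · intro h
    have main : ∀ η > 0, ∀ᶠ n in atTop, A n < η := by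
      intro η hη
      set D := (2 + K1 * (C + 1)) with hD
      have hDpos : 0 < D := by positivity
      have hε : 0 < η / (2 * D) := by positivity
      have hη2 : 0 < η / 2 / K1 := by positivity
      filter_upwards [key _ hε, h.eventually (gt_mem_nhds hη2)] with n h1 h2
      have h3 : K1 * B n < η / 2 := by rw [lt_div_iff₀ hK1] at h2; linarith
      have h4 : D * (η / (2 * D)) = η / 2 := by field_simp
      have h5 := h1.1
      linarith
    refine tendsto_order.2 ⟨fun a ha => Eventually.of_forall fun n => lt_of_lt_of_le ha (hA0 n), main⟩
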